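/- arXiv:math/0311160 — 3 statements merged into one kernel-verified Lean document; each statement's English description precedes it below -/
import Mathlib

section
/- For every nonempty bounded interval I = (a,b] ⊂ ℝ (a < b), letting N be the unique integer with 2^{−N−1}/3 ≤ b − a < 2^{−N}/3, there exists an integer k such that either I ⊆ D_N^k or I ⊆ D'_N^k; in particular I is contained in an atom of D_N or of D'_N whose length 2^{−N} satisfies 2^{−N} ≤ 6(b − a). -/
open Set

/-- The atom `D_n^k = (k·2^{-n}, (k+1)·2^{-n}]` of the `n`-th usual dyadic partition of `ℝ`. -/
noncomputable def dyadicAtom (n k : ℤ) : Set ℝ :=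
  Set.Ioc ((k : ℝ) * (2 : ℝ) ^ (-n)) (((k : ℝ) + 1) * (2 : ℝ) ^ (-n))

/-- The atom `D'_n^k` of the `n`-th shifted dyadic partition of `ℝ`:
`((k+1/3)·2^{-n}, (k+4/3)·2^{-n}]` for even `n`, and
`((k+2/3)·2^{-n}, (k+5/3)·2^{-n}]` for odd `n`. -/
noncomputable def dyadicAtom' (n k : ℤ) : Set ℝ :=
  if Even n then
    Set.Ioc (((k : ℝ) + 1 / 3) * (2 : ℝ) ^ (-n)) (((k : ℝ) + 4 / 3) * (2 : ℝ) ^ (-n))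
  else
    Set.Ioc (((k : ℝ) + 2 / 3) * (2 : ℝ) ^ (-n)) (((k : ℝ) + 5 / 3) * (2 : ℝ) ^ (-n))

/-- Any bounded interval `(a, b]` with `2^{-N-1}/3 ≤ b − a < 2^{-N}/3` is contained
in an atom of `D_N` or of `D'_N`, whose common length `2^{-N}` is at most `6(b − a)`. -/
theorem stmt0 (a b : ℝ) (hab : a < b) (N : ℤ)
    (hN₁ : (2 : ℝ) ^ (-N - 1) / 3 ≤ b - a) (hN₂ : b - a < (2 : ℝ) ^ (-N) / 3) :
    (∃ k : ℤ, Set.Ioc a b ⊆ dyadicAtom N k ∨ Set.Ioc a b ⊆ dyadicAtom' N k) ∧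
      (2 : ℝ) ^ (-N) ≤ 6 * (b - a) := by
  have ht : (0 : ℝ) < (2 : ℝ) ^ (-N) := by positivity
  rw [zpow_sub₀ (by norm_num), zpow_one] at hN₁
  generalize htt : (2 : ℝ) ^ (-N) = t at *
  refine ⟨⟨⌊a / t⌋, ?_⟩, by linarith⟩
  have h1 : (⌊a / t⌋ : ℝ) * t ≤ a := (le_div_iff₀ ht).1 (Int.floor_le _)
  have h2 : a < ((⌊a / t⌋ : ℝ) + 1) * t := (div_lt_iff₀ ht).1 (Int.lt_floor_add_one _)
  by_cases hb : b ≤ ((⌊a / t⌋ : ℝ) + 1) * t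
  · left
    unfold dyadicAtom
    rw [htt]
    exact Set.Ioc_subset_Ioc h1 hb
  · right
    unfold dyadicAtom'
    rw [htt]
    split_ifs
    · exact Set.Ioc_subset_Ioc (by linarith) (by linarith)
    · exact Set.Ioc_subset_Ioc (by linarith) (by linarith)
end

section
/- Let f : ℝ → [0,∞) be locally integrable, t ∈ ℝ and h₁, h₂ > 0. Then there exist integers N, k and an interval J which is either the atom D_N^k or the atom D'_N^k, such that t ∈ J, (t − h₁, t + h₂] ⊆ J, |J| = 2^{−N} ≤ 6(h₁ + h₂), and consequently (1/(h₁+h₂)) ∫_{t−h₁}^{t+h₂} f(x) dx ≤ (6/|J|) ∫_J f(x) dx. -/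
open Set MeasureTheory

theorem aux_final (f : ℝ → ℝ) (hf0 : ∀ x, 0 ≤ f x) (hf : LocallyIntegrable f volume)
    (t h₁ h₂ s u v : ℝ) (hh₁ : 0 < h₁) (hh₂ : 0 < h₂) (hs : 0 < s) (hs6 : s ≤ 6 * (h₁ + h₂))
    (hu : u ≤ t - h₁) (hv : t + h₂ ≤ v) :
    t ∈ Set.Ioc u v ∧ Set.Ioc (t - h₁) (t + h₂) ⊆ Set.Ioc u v ∧ s ≤ 6 * (h₁ + h₂) ∧
      (1 / (h₁ + h₂)) * ∫ x in Set.Ioc (t - h₁) (t + h₂), f x ≤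
        (6 / s) * ∫ x in Set.Ioc u v, f x := by
  have hsub : Set.Ioc (t - h₁) (t + h₂) ⊆ Set.Ioc u v := Set.Ioc_subset_Ioc hu hv
  refine ⟨⟨by linarith, by linarith⟩, hsub, hs6, ?_⟩
  have hint : IntegrableOn f (Set.Ioc u v) volume :=
    (hf.integrableOn_isCompact isCompact_Icc).mono_set Set.Ioc_subset_Icc_self
  have h1 : ∫ x in Set.Ioc (t - h₁) (t + h₂), f x ≤ ∫ x in Set.Ioc u v, f x :=
    setIntegral_mono_set hint (Filter.Eventually.of_forall hf0) hsub.eventuallyLE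
  have h0 : 0 ≤ ∫ x in Set.Ioc (t - h₁) (t + h₂), f x := integral_nonneg hf0
  have h2 : 1 / (h₁ + h₂) ≤ 6 / s := by
    rw [div_le_div_iff₀ (by linarith) hs]; linarith
  exact mul_le_mul h2 h1 h0 (by positivity)

/-- For a nonnegative locally integrable `f`, any average of `f` over an interval
`(t − h₁, t + h₂]` is dominated by `6` times the average of `f` over an atom `J` of some usual
or shifted dyadic partition containing the interval of comparable length `|J| = 2^{-N} ≤ 6(h₁+h₂)`. -/
theorem stmt1 (f : ℝ → ℝ) (hf0 : ∀ x, 0 ≤ f x) (hf : LocallyIntegrable f volume)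
    (t h₁ h₂ : ℝ) (hh₁ : 0 < h₁) (hh₂ : 0 < h₂) :
    ∃ (N k : ℤ) (J : Set ℝ), (J = dyadicAtom N k ∨ J = dyadicAtom' N k) ∧
      t ∈ J ∧ Set.Ioc (t - h₁) (t + h₂) ⊆ J ∧ (2 : ℝ) ^ (-N) ≤ 6 * (h₁ + h₂) ∧
      (1 / (h₁ + h₂)) * ∫ x in Set.Ioc (t - h₁) (t + h₂), f x ≤
        (6 / (2 : ℝ) ^ (-N)) * ∫ x in J, f x := by
  obtain ⟨n, hn1, hn2⟩ := exists_mem_Ioc_zpow (x := 3 * (h₁ + h₂)) (y := (2 : ℝ))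
    (by linarith) (by norm_num)
  have hs : (0 : ℝ) < (2 : ℝ) ^ (- -(n + 1)) := by positivity
  have hs3 : 3 * (h₁ + h₂) ≤ (2 : ℝ) ^ (- -(n + 1)) := by rwa [neg_neg]
  have hs6 : (2 : ℝ) ^ (- -(n + 1)) ≤ 6 * (h₁ + h₂) := by
    rw [neg_neg, zpow_add_one₀ (by norm_num)]; linarith
  generalize hN : -(n + 1) = N at hs hs3 hs6
  clear hn1 hn2
  have hk1 := Int.floor_le ((t - h₁) / (2 : ℝ) ^ (-N))
  have hk2 := Int.lt_floor_add_one ((t - h₁) / (2 : ℝ) ^ (-N))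
  generalize ⌊(t - h₁) / (2 : ℝ) ^ (-N)⌋ = k at hk1 hk2
  rw [le_div_iff₀ hs] at hk1
  rw [div_lt_iff₀ hs] at hk2
  by_cases hb : t + h₂ ≤ ((k : ℝ) + 1) * (2 : ℝ) ^ (-N)
  · exact ⟨N, k, _, Or.inl rfl, aux_final f hf0 hf t h₁ h₂ _ _ _ hh₁ hh₂ hs hs6 hk1 hb⟩
  · push Not at hb
    refine ⟨N, k, _, Or.inr rfl, ?_⟩
    unfold dyadicAtom'
    split_ifs
    · exact aux_final f hf0 hf t h₁ h₂ _ _ _ hh₁ hh₂ hs hs6 (by linarith) (by linarith)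
    · exact aux_final f hf0 hf t h₁ h₂ _ _ _ hh₁ hh₂ hs hs6 (by linarith) (by linarith)
end

section
/- There is a universal constant c > 0 with the following property. Let H be a complex Hilbert space and φ : ℝ → B(H) locally Bochner integrable with ∫_ℝ ‖φ(t)‖²/(1+t²) dt < ∞ and ‖φ‖_{BMO_c} < ∞. Then sup_{h ∈ H, ‖h‖ ≤ 1} ( ∫_ℝ ‖φ(t)h‖²/(1+t²) dt )^{1/2} ≤ c·( ‖φ‖_{BMO_c} + ‖φ_{I₁}‖ ), where I₁ = (−1, 1] and ‖φ_{I₁}‖ is the operator norm of the average φ_{I₁} = (1/2)∫_{I₁} φ. -/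
open MeasureTheory

variable {H : Type*} [NormedAddCommGroup H] [InnerProductSpace ℂ H] [CompleteSpace H]

/-- The average `φ_I = (1/|I|) ∫_I φ` of an operator-valued function over the interval
`I = (a, b]`. -/
noncomputable def intervalAvg (φ : ℝ → H →L[ℂ] H) (a b : ℝ) : H →L[ℂ] H :=
  (b - a)⁻¹ • ∫ s in Set.Ioc a b, φ s

/-- The column BMO norm of an operator-valued function `φ : ℝ → B(H)`:
`sup_I sup_{‖v‖≤1} ((1/|I|) ∫_I ‖(φ(s) − φ_I) v‖² ds)^{1/2}`, as a value in `[0, ∞]`. -/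
noncomputable def bmoCNorm (φ : ℝ → H →L[ℂ] H) : ENNReal :=
  ⨆ (a : ℝ) (b : ℝ) (_ : a < b) (v : H) (_ : ‖v‖ ≤ 1),
    ENNReal.ofReal
      (Real.sqrt ((b - a)⁻¹ * ∫ s in Set.Ioc a b, ‖(φ s - intervalAvg φ a b) v‖ ^ 2))

theorem stmt6_core {E : Type*} [NormedAddCommGroup E] (f : ℝ → E)
    (hm : AEStronglyMeasurable f volume)
    (hi : Integrable (fun t => ‖f t‖ ^ 2 / (1 + t ^ 2))) (u : ℕ → E) (M A : ℝ) (hM : 0 ≤ M)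
    (h0 : ‖u 0‖ ≤ A)
    (hu : ∀ n : ℕ, ∫ s in Set.Ioc (-(2:ℝ) ^ n) (2 ^ n), ‖f s - u n‖ ^ 2 ≤ 2 * 2 ^ n * M ^ 2) :
    ∫ t, ‖f t‖ ^ 2 / (1 + t ^ 2) ≤ 1156 * (M + A) ^ 2 := by
  have hA : 0 ≤ A := (norm_nonneg _).trans h0
  have hp : ∀ n : ℕ, (0:ℝ) < 2 ^ n := fun n => by positivity
  have hsub : ∀ n : ℕ, Set.Ioc (-(2:ℝ) ^ n) (2 ^ n) ⊆ Set.Ioc (-(2:ℝ) ^ (n+1)) (2 ^ (n+1)) := by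
    intro n
    have := hp n
    apply Set.Ioc_subset_Ioc <;> rw [pow_succ] <;> linarith
  have hvol : ∀ n : ℕ, volume.real (Set.Ioc (-(2:ℝ) ^ n) (2 ^ n)) = 2 * 2 ^ n := by
    intro n
    have := hp n
    rw [Real.volume_real_Ioc_of_le (by linarith)]; ring
  have hg : ∀ n : ℕ, IntegrableOn (fun t => ‖f t‖ ^ 2) (Set.Ioc (-(2:ℝ) ^ n) (2 ^ n)) := by
    intro n
    refine Integrable.mono' ((hi.integrableOn (s := Set.Ioc (-(2:ℝ) ^ n) (2 ^ n))).const_mul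
      (1 + ((2:ℝ)^n)^2)) (hm.norm.pow 2).restrict ?_
    filter_upwards [ae_restrict_mem measurableSet_Ioc] with t ht
    have h1 : t ^ 2 ≤ ((2:ℝ)^n)^2 := by
      apply sq_le_sq'
      · exact ht.1.le
      · exact ht.2
    rw [Real.norm_of_nonneg (by positivity), ← mul_div_assoc, le_div_iff₀ (by positivity)]
    nlinarith [sq_nonneg ‖f t‖]
  have hL : ∀ n : ℕ, MemLp f 2 (volume.restrict (Set.Ioc (-(2:ℝ) ^ n) (2 ^ n))) := fun n =>
    (memLp_two_iff_integrable_sq_norm hm.restrict).2 (hg n)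
  have hd : ∀ (n : ℕ) (w : E),
      IntegrableOn (fun t => ‖f t - w‖ ^ 2) (Set.Ioc (-(2:ℝ) ^ n) (2 ^ n)) := fun n w =>
    ((hL n).sub (memLp_const w)).integrable_norm_pow (by norm_num)
  have hmono : ∀ (n : ℕ) (w : E), ∫ s in Set.Ioc (-(2:ℝ) ^ n) (2 ^ n), ‖f s - w‖ ^ 2 ≤
      ∫ s in Set.Ioc (-(2:ℝ) ^ (n+1)) (2 ^ (n+1)), ‖f s - w‖ ^ 2 := fun n w =>
    setIntegral_mono_set (hd (n+1) w) (Filter.Eventually.of_forall fun t => by positivity)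
      (HasSubset.Subset.eventuallyLE (hsub n))
  have hstep : ∀ n : ℕ, ‖u (n+1)‖ ≤ ‖u n‖ + 3 * M := by
    intro n
    have h1 : ∫ s in Set.Ioc (-(2:ℝ) ^ n) (2 ^ n), ‖u (n+1) - u n‖ ^ 2 ≤
        ∫ s in Set.Ioc (-(2:ℝ) ^ n) (2 ^ n),
          (2 * ‖f s - u n‖ ^ 2 + 2 * ‖f s - u (n+1)‖ ^ 2) := by
      apply integral_mono
      · exact integrable_const _
      · exact ((hd n _).const_mul 2).add ((hd n _).const_mul 2)
      · intro s
        have : ‖u (n+1) - u n‖ ≤ ‖f s - u n‖ + ‖f s - u (n+1)‖ := by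
          have := norm_sub_le (f s - u n) (f s - u (n+1))
          simpa using this
        have h2 := pow_le_pow_left₀ (norm_nonneg _) this 2
        dsimp only
        nlinarith [sq_nonneg (‖f s - u n‖ - ‖f s - u (n+1)‖)]
    rw [integral_add ((hd n _).const_mul 2) ((hd n _).const_mul 2), integral_const_mul,
      integral_const_mul, setIntegral_const, hvol, smul_eq_mul] at h1
    have h2 := hu n
    have h3 := (hmono n (u (n+1))).trans (hu (n+1))
    have h4 : (2 * 2 ^ n) * ‖u (n+1) - u n‖ ^ 2 ≤ (2 * (2:ℝ) ^ n) * (6 * M ^ 2) := by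
      rw [pow_succ] at h3
      linarith
    have h5 := le_of_mul_le_mul_left h4 (by positivity)
    have h6 : ‖u (n+1) - u n‖ ≤ 3 * M := by
      apply le_of_sq_le_sq _ (by positivity)
      nlinarith [sq_nonneg M]
    have h7 := norm_add_le (u n) (u (n+1) - u n)
    rw [add_sub_cancel] at h7
    linarith
  have hun : ∀ n : ℕ, ‖u n‖ ≤ A + 3 * n * M := by
    intro n
    induction n with
    | zero => simpa using h0
    | succ n ih =>
      have := hstep n
      push_cast
      linarith
  have hgb : ∀ n : ℕ, ∫ s in Set.Ioc (-(2:ℝ) ^ n) (2 ^ n), ‖f s‖ ^ 2 ≤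
      4 * 2 ^ n * ((9 * n ^ 2 + 6 * n + 2) * (M + A) ^ 2) := by
    intro n
    have h1 : ∫ s in Set.Ioc (-(2:ℝ) ^ n) (2 ^ n), ‖f s‖ ^ 2 ≤
        ∫ s in Set.Ioc (-(2:ℝ) ^ n) (2 ^ n), (2 * ‖f s - u n‖ ^ 2 + 2 * ‖u n‖ ^ 2) := by
      apply integral_mono
      · exact hg n
      · exact ((hd n _).const_mul 2).add (integrable_const _)
      · intro s
        have : ‖f s‖ ≤ ‖f s - u n‖ + ‖u n‖ := by
          have := norm_add_le (f s - u n) (u n)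
          simpa using this
        have h2 := pow_le_pow_left₀ (norm_nonneg _) this 2
        dsimp only
        nlinarith [sq_nonneg (‖f s - u n‖ - ‖u n‖)]
    rw [integral_add ((hd n _).const_mul 2) (integrable_const _), integral_const_mul,
      setIntegral_const, hvol, smul_eq_mul] at h1
    have h2 := hu n
    have h3 : ‖u n‖ ≤ (1 + 3 * n) * (M + A) := by
      have hn : (0:ℝ) ≤ n := Nat.cast_nonneg n
      nlinarith [hun n, mul_nonneg hn hA]
    have h4 := pow_le_pow_left₀ (norm_nonneg _) h3 2
    have h5 : M ^ 2 ≤ (M + A) ^ 2 := pow_le_pow_left₀ hM (by linarith) 2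
    have h6 : M ^ 2 + ‖u n‖ ^ 2 ≤ (9 * n ^ 2 + 6 * n + 2) * (M + A) ^ 2 := by linarith
    have h7 := mul_le_mul_of_nonneg_left h6 (by positivity : (0:ℝ) ≤ 4 * 2 ^ n)
    linarith
  have hmain : ∀ n : ℕ, ∫ t in Set.Ioc (-(2:ℝ) ^ n) (2 ^ n), ‖f t‖ ^ 2 / (1 + t ^ 2) ≤
      16 * (M + A) ^ 2 * (70 - (18 * (n+1) ^ 2 + 48 * (n+1) + 70) / (2 * 2 ^ n)) := by
    intro n
    induction n with
    | zero =>
      have h1 : ∫ t in Set.Ioc (-(2:ℝ) ^ 0) (2 ^ 0), ‖f t‖ ^ 2 / (1 + t ^ 2) ≤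
          ∫ t in Set.Ioc (-(2:ℝ) ^ 0) (2 ^ 0), ‖f t‖ ^ 2 := by
        apply integral_mono hi.integrableOn (hg 0)
        intro t
        exact div_le_self (by positivity) (by nlinarith [sq_nonneg t])
      have h2 := hgb 0
      norm_num at h1 h2 ⊢
      nlinarith [sq_nonneg (M + A)]
    | succ n ih =>
      set S := Set.Ioc (-(2:ℝ) ^ n) (2 ^ n)
      set T := Set.Ioc (-(2:ℝ) ^ (n+1)) (2 ^ (n+1)) with hT
      have hTS : T = S ∪ (T \ S) := (Set.union_sdiff_cancel (hsub n)).symm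
      have h1 : ∫ t in T, ‖f t‖ ^ 2 / (1 + t ^ 2) = (∫ t in S, ‖f t‖ ^ 2 / (1 + t ^ 2)) +
          ∫ t in T \ S, ‖f t‖ ^ 2 / (1 + t ^ 2) := by
        conv_lhs => rw [hTS]
        exact setIntegral_union Set.disjoint_sdiff_right
          (measurableSet_Ioc.diff measurableSet_Ioc) hi.integrableOn hi.integrableOn
      have hgT : IntegrableOn (fun t => ‖f t‖ ^ 2) T := hg (n+1)
      have h2 : ∫ t in T \ S, ‖f t‖ ^ 2 / (1 + t ^ 2) ≤
          ∫ t in T \ S, (((2:ℝ) ^ n) ^ 2)⁻¹ * ‖f t‖ ^ 2 := by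
        apply setIntegral_mono_on hi.integrableOn
          ((hgT.mono_set Set.sdiff_subset).const_mul _)
          (measurableSet_Ioc.diff measurableSet_Ioc)
        intro t ht
        have h3 : ((2:ℝ) ^ n) ^ 2 ≤ t ^ 2 := by
          have := hp n
          by_contra hc
          push Not at hc
          have h4 := abs_lt_of_sq_lt_sq' hc this.le
          exact ht.2 ⟨h4.1, h4.2.le⟩
        rw [div_eq_inv_mul]
        gcongr
        linarith
      have h3 : ∫ t in T \ S, (((2:ℝ) ^ n) ^ 2)⁻¹ * ‖f t‖ ^ 2 ≤
          (((2:ℝ) ^ n) ^ 2)⁻¹ * ∫ t in T, ‖f t‖ ^ 2 := by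
        rw [integral_const_mul]
        gcongr
        · exact Filter.Eventually.of_forall fun t => by positivity
        · exact Set.sdiff_subset
      have h4 := mul_le_mul_of_nonneg_left (hgb (n+1))
        (by positivity : (0:ℝ) ≤ (((2:ℝ) ^ n) ^ 2)⁻¹)
      have h5 : (((2:ℝ) ^ n) ^ 2)⁻¹ * (4 * 2 ^ (n+1) *
          ((9 * ((n+1:ℕ):ℝ) ^ 2 + 6 * ((n+1:ℕ):ℝ) + 2) * (M + A) ^ 2)) +
          16 * (M + A) ^ 2 * (70 - (18 * ((n:ℝ)+1) ^ 2 + 48 * (n+1) + 70) / (2 * 2 ^ n)) =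
          16 * (M + A) ^ 2 * (70 - (18 * (((n+1:ℕ):ℝ)+1) ^ 2 + 48 * (((n+1:ℕ):ℝ)+1) + 70) /
            (2 * 2 ^ (n+1))) := by
        have := (hp n).ne'
        rw [pow_succ (2:ℝ) n]
        push_cast
        field_simp
        ring
      rw [h1, ← h5]
      linarith
  have hpow : Filter.Tendsto (fun n : ℕ => (2:ℝ) ^ n) Filter.atTop Filter.atTop :=
    tendsto_pow_atTop_atTop_of_one_lt (by norm_num)
  have hlim := intervalIntegral_tendsto_integral hi
    (Filter.tendsto_neg_atTop_atBot.comp hpow) hpow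
  refine le_of_tendsto hlim (Filter.Eventually.of_forall fun n => ?_)
  have := hp n
  simp only [Function.comp]
  rw [intervalIntegral.integral_of_le (by linarith)]
  refine (hmain n).trans ?_
  have h1 : 0 ≤ (18 * ((n:ℝ)+1) ^ 2 + 48 * (n+1) + 70) / (2 * 2 ^ n) := by positivity
  nlinarith [sq_nonneg (M + A), mul_nonneg (sq_nonneg (M + A)) h1]

/-- There is a universal constant `c > 0` such that every operator-valued `φ` in `BMO_c` with
`∫ ‖φ(t)‖²/(1+t²) dt < ∞` satisfies
`sup_{‖h‖≤1} (∫ ‖φ(t)h‖²/(1+t²) dt)^{1/2} ≤ c·(‖φ‖_{BMO_c} + ‖φ_{(-1,1]}‖)`. -/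
theorem stmt6 :
    ∃ c : ℝ, 0 < c ∧
      ∀ (H : Type) (_ : NormedAddCommGroup H), ∀ (_ : InnerProductSpace ℂ H)
        (_ : CompleteSpace H) (φ : ℝ → H →L[ℂ] H),
        LocallyIntegrable φ volume →
        Integrable (fun t => ‖φ t‖ ^ 2 / (1 + t ^ 2)) →
        bmoCNorm φ ≠ ⊤ →
        ∀ v : H, ‖v‖ ≤ 1 →
          Real.sqrt (∫ t, ‖φ t v‖ ^ 2 / (1 + t ^ 2)) ≤
            c * ((bmoCNorm φ).toReal + ‖intervalAvg φ (-1) 1‖) := by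
  refine ⟨34, by norm_num, ?_⟩
  intro H _ _ _ φ hloc hint hbmo v hv
  have hle : ∀ t, ‖φ t v‖ ≤ ‖φ t‖ := fun t =>
    ((φ t).le_opNorm v).trans (mul_le_of_le_one_right (norm_nonneg _) hv)
  have hm : AEStronglyMeasurable (fun t => φ t v) volume :=
    (ContinuousLinearMap.apply ℂ H v).continuous.comp_aestronglyMeasurable
      hloc.aestronglyMeasurable
  have hi : Integrable (fun t => ‖φ t v‖ ^ 2 / (1 + t ^ 2)) := by
    refine hint.mono' ?_ (Filter.Eventually.of_forall fun t => ?_)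
    · have : AEMeasurable (fun t => ‖φ t v‖ ^ 2 / (1 + t ^ 2)) volume :=
        (hm.norm.aemeasurable.pow_const 2).div (by fun_prop)
      exact this.aestronglyMeasurable
    · rw [Real.norm_of_nonneg (by positivity)]
      have := hle t
      gcongr
  have key := stmt6_core (fun t => φ t v) hm hi
    (fun n => intervalAvg φ (-(2:ℝ) ^ n) (2 ^ n) v) (bmoCNorm φ).toReal
    ‖intervalAvg φ (-1) 1‖ ENNReal.toReal_nonneg ?_ ?_
  · apply Real.sqrt_le_iff.2
    refine ⟨by positivity, key.trans (le_of_eq (by ring))⟩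
  · simp only [pow_zero]
    exact ((intervalAvg φ (-1) 1).le_opNorm v).trans
      (mul_le_of_le_one_right (norm_nonneg _) hv)
  · intro n
    have hp : (0:ℝ) < 2 ^ n := by positivity
    have hab : -(2:ℝ) ^ n < 2 ^ n := by linarith
    have h1 : ENNReal.ofReal (Real.sqrt (((2:ℝ) ^ n - -(2:ℝ) ^ n)⁻¹ *
        ∫ s in Set.Ioc (-(2:ℝ) ^ n) (2 ^ n),
          ‖(φ s - intervalAvg φ (-(2:ℝ) ^ n) (2 ^ n)) v‖ ^ 2)) ≤ bmoCNorm φ := by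
      unfold bmoCNorm
      exact le_iSup_of_le _ (le_iSup_of_le _ (le_iSup_of_le hab (le_iSup_of_le v
        (le_iSup_of_le hv le_rfl))))
    have h2 := (ENNReal.ofReal_le_iff_le_toReal hbmo).1 h1
    have h3 := (Real.sqrt_le_left ENNReal.toReal_nonneg).1 h2
    rw [inv_mul_le_iff₀ (by linarith)] at h3
    simp only [ContinuousLinearMap.sub_apply] at h3
    refine h3.trans (le_of_eq (by ring))
end
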